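/- Let α be a weak composition with partition rearrangement λ and let λ^T be the transpose (conjugate) partition of λ. For any flag φ, the unique highest weight element of the crystal SSKT(α,φ) (i.e., the unique T ∈ SSKT(α,φ) with e_i(T) = 0 for all i ≥ 1) is the tableau of shape α in which column i is filled by the numbers 1, 2, …, λ^T_i in increasing order from bottom to top. -/

import Mathlib

noncomputable section
attribute [local instance] Classical.propDecidable

/-! ### Words, permutations, reduced words -/

/-- The adjacent transposition `s_i` exchanging `i` and `i+1`. -/
def sPerm (i : ℕ) : Equiv.Perm ℕ := Equiv.swap i (i + 1)

/-- The permutation `s_{i_1} ⋯ s_{i_n}` represented by the word `i_1 ⋯ i_n`. -/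
def wordPerm (ρ : List ℕ) : Equiv.Perm ℕ := (ρ.map sPerm).prod

/-- A word whose letters are positive integers. -/
def PosWord (ρ : List ℕ) : Prop := ∀ x ∈ ρ, 1 ≤ x

/-- A reduced word: a word of positive integers of minimal length among all words of
positive integers representing the same permutation. -/
def IsReducedWord (ρ : List ℕ) : Prop :=
  PosWord ρ ∧ ∀ σ : List ℕ, PosWord σ → wordPerm σ = wordPerm ρ → ρ.length ≤ σ.length

/-- `ρ` is a reduced word for the permutation `w`. -/
def IsReducedWordFor (w : Equiv.Perm ℕ) (ρ : List ℕ) : Prop :=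
  IsReducedWord ρ ∧ wordPerm ρ = w

/-- A member of `S∞`: a permutation of the positive integers (it fixes `0`)
fixing all but finitely many points. -/
def FinitaryPerm (w : Equiv.Perm ℕ) : Prop := w 0 = 0 ∧ {i : ℕ | w i ≠ i}.Finite

/-- A flag: a weakly increasing function `φ : ℤ_{>0} → ℤ_{>0}` with `φ(n) ≥ n`. -/
def IsFlag (φ : ℕ → ℕ) : Prop :=
  (∀ m n : ℕ, 1 ≤ m → m ≤ n → φ m ≤ φ n) ∧ ∀ n : ℕ, 1 ≤ n → n ≤ φ n

/-- A weak composition, as a function on the positive integers (value `0` at `0`)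
with finitely many nonzero entries. -/
def WeakComp (α : ℕ → ℕ) : Prop := α 0 = 0 ∧ {i : ℕ | α i ≠ 0}.Finite

/-- `φ - e_i`, i.e. `l ↦ φ(l) - δ_{il}`. -/
def subE (φ : ℕ → ℕ) (i : ℕ) : ℕ → ℕ := fun l => if l = i then φ l - 1 else φ l

/-- The right action of `s_i` on weak compositions, swapping entries `i` and `i+1`. -/
def swapC (α : ℕ → ℕ) (i : ℕ) : ℕ → ℕ := fun j => α (sPerm i j)

/-- `α` has length `k`: `k` is minimal with `α i = 0` for all `i > k`. -/
def HasLen (α : ℕ → ℕ) (k : ℕ) : Prop :=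
  (∀ i, k < i → α i = 0) ∧ ∀ m, (∀ i, m < i → α i = 0) → k ≤ m

/-! ### Coxeter–Knuth equivalence -/

/-- One Coxeter–Knuth move. -/
def CKStep (u v : List ℕ) : Prop :=
  (∃ (a b : List ℕ) (x y z : ℕ), y < x ∧ x < z ∧
      u = a ++ [x, y, z] ++ b ∧ v = a ++ [x, z, y] ++ b) ∨
  (∃ (a b : List ℕ) (x y z : ℕ), y < z ∧ z < x ∧
      u = a ++ [x, y, z] ++ b ∧ v = a ++ [y, x, z] ++ b) ∨
  (∃ (a b : List ℕ) (i : ℕ),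
      u = a ++ [i, i + 1, i] ++ b ∧ v = a ++ [i + 1, i, i + 1] ++ b)

/-- Coxeter–Knuth equivalence: the transitive (symmetric, reflexive) closure of `CKStep`. -/
def CKEquiv : List ℕ → List ℕ → Prop := Relation.EqvGen CKStep

/-! ### Run factorizations and weak descent tableaux -/

/-- The run factorization of a word into maximal strictly increasing blocks
(listed from left to right). -/
def runFact : List ℕ → List (List ℕ)
  | [] => []
  | a :: rest =>
    match runFact rest with
    | [] => [[a]]
    | r :: rs => if a < r.headI then (a :: r) :: rs else [a] :: r :: rs

/-- Auxiliary: rows of the remaining blocks, given the row of the previous block. -/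
def wdtRowsAux : ℤ → List (List ℕ) → List ℤ
  | _, [] => []
  | prev, b :: bs =>
      min (prev - 1) (b.headI : ℤ) :: wdtRowsAux (min (prev - 1) (b.headI : ℤ)) bs

/-- The row indices assigned to the blocks of a run factorization (blocks listed
left to right): the leftmost block goes to the row indexed by its first letter, and each
subsequent block goes to the row indexed by its first letter if this is below the previous
block's row, and otherwise directly below the previous block's row. -/
def wdtRows : List (List ℕ) → List ℤ
  | [] => []
  | b :: bs => (b.headI : ℤ) :: wdtRowsAux (b.headI : ℤ) bs

/-- A tableau: rows indexed by `ℤ` (bottom to top), columns indexed by `ℕ` starting at `1`;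
the value `0` means that there is no box, a nonzero value is the (positive) entry. -/
abbrev Tableau := ℤ → ℕ → ℕ

/-- The weak descent tableau of a word. -/
def weakDesTab (ρ : List ℕ) : Tableau := fun r c =>
  if c = 0 then 0
  else
    match ((wdtRows (runFact ρ)).zip (runFact ρ)).find? (fun p => decide (p.1 = r)) with
    | some p => p.2.getD (c - 1) 0
    | none => 0

/-- A word is non-virtual if its weak descent tableau only occupies rows of positive index. -/
def NonVirtual (ρ : List ℕ) : Prop := ∀ r ∈ wdtRows (runFact ρ), 1 ≤ r

/-- The shape of a tableau: the number of boxes in each (positively indexed) row. -/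
def shapeOf (T : Tableau) : ℕ → ℕ := fun i => Set.ncard {c : ℕ | T (i : ℤ) c ≠ 0}

/-- The weak descent composition of a word: the shape of its weak descent tableau. -/
def desComp (ρ : List ℕ) : ℕ → ℕ := shapeOf (weakDesTab ρ)

/-- Partial-sum (dominance) order on weak compositions. -/
def compLE (μ ν : ℕ → ℕ) : Prop :=
  ∀ k : ℕ, ∑ i ∈ Finset.Icc 1 k, μ i ≤ ∑ i ∈ Finset.Icc 1 k, ν i

/-- A Yamanouchi reduced word: a non-virtual reduced word that is minimal in its
Coxeter–Knuth class among non-virtual words, for the order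
`ρ ≤ τ ↔ ρ ~ τ ∧ des ρ ≤ des τ`. -/
def Yamanouchi (ρ : List ℕ) : Prop :=
  IsReducedWord ρ ∧ NonVirtual ρ ∧
    ∀ σ : List ℕ, NonVirtual σ → CKEquiv ρ σ → compLE (desComp ρ) (desComp σ)

/-- The (unique) Yamanouchi reduced word Coxeter–Knuth equivalent to `ρ`. -/
def hatRho (ρ : List ℕ) : List ℕ :=
  if h : ∃ σ, Yamanouchi σ ∧ CKEquiv ρ σ then h.choose else []

/-- The weak Edelman–Greene insertion tableau of a word: the weak descent tableau of the
unique Yamanouchi reduced word Coxeter–Knuth equivalent to it. -/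
def hatP (ρ : List ℕ) : Tableau := weakDesTab (hatRho ρ)

/-! ### Factorizations -/

/-- The factorization `f : ℕ → List ℕ` stores the block `ρ^{(i)}` at index `i ≥ 1`
(blocks indexed from the right); the largest index of a nonempty block. -/
def topIdx (f : ℕ → List ℕ) : ℕ := sSup {i : ℕ | f i ≠ []}

/-- The concatenation `ρ^{(top)} ⋯ ρ^{(i+1)} ρ^{(i)}` of the blocks of `f` with index `≥ i`. -/
def factWordGe (f : ℕ → List ℕ) (i : ℕ) : List ℕ :=
  ((((List.range (topIdx f + 1)).reverse).filter (fun j => decide (i ≤ j))).map f).foldr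
    (· ++ ·) []

/-- The underlying word of a factorization. -/
def factWord (f : ℕ → List ℕ) : List ℕ := factWordGe f 0

/-- The weak Edelman–Greene recording tableau of a factorization: it has the same shape as
the weak EG insertion tableau of the underlying word, and has entry `i` in all boxes of
`P̂(ρ^{(k)}|⋯|ρ^{(i)})` that are not in `P̂(ρ^{(k)}|⋯|ρ^{(i+1)})`. -/
def hatQfact (f : ℕ → List ℕ) : Tableau := fun r c =>
  sSup {i : ℕ | 1 ≤ i ∧ hatP (factWordGe f i) r c ≠ 0 ∧ hatP (factWordGe f (i + 1)) r c = 0}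

/-- Every block is strictly increasing. -/
def IncreasingFact (f : ℕ → List ℕ) : Prop := ∀ i, List.Chain' (· < ·) (f i)

/-- The factorization is `φ`-flagged: every nonempty block `ρ^{(i)}` has first letter
`ρ^{(i)}_1` with `φ(ρ^{(i)}_1) ≥ i`. -/
def FlaggedFact (φ : ℕ → ℕ) (f : ℕ → List ℕ) : Prop :=
  ∀ i, f i ≠ [] → i ≤ φ ((f i).headI)

/-- `RFC(w, φ)`: all `φ`-flagged increasing factorizations of reduced words for `w`. -/
def RFCset (w : Equiv.Perm ℕ) (φ : ℕ → ℕ) : Set (ℕ → List ℕ) :=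
  {f | f 0 = [] ∧ {i : ℕ | f i ≠ []}.Finite ∧ IncreasingFact f ∧ FlaggedFact φ f ∧
       IsReducedWordFor w (factWord f)}

/-- `RF_n(w)`: increasing factorizations of reduced words for `w` with exactly `n` blocks
(indexed `1, …, n`, possibly empty). -/
def RFn (n : ℕ) (w : Equiv.Perm ℕ) : Set (ℕ → List ℕ) :=
  {f | f 0 = [] ∧ (∀ j, n < j → f j = []) ∧ IncreasingFact f ∧
       IsReducedWordFor w (factWord f)}

/-- `RFC_n(w, φ)`: the `φ`-flagged elements of `RF_n(w)`. -/
def RFCn (n : ℕ) (w : Equiv.Perm ℕ) (φ : ℕ → ℕ) : Set (ℕ → List ℕ) :=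
  {f | f ∈ RFn n w ∧ FlaggedFact φ f}

/-! ### Morse–Schilling crystal operators -/

/-- Pairing procedure: first argument is the block `r^{(i)}` in *decreasing* order, second is
the not-yet-paired part of the block `r^{(i+1)}` (in increasing order). Each letter `b` of
`r^{(i)}`, from largest to smallest, is paired with the smallest still unpaired letter of
`r^{(i+1)}` strictly larger than `b`. Returns the unpaired letters of `r^{(i+1)}`. -/
def unpairedUpper : List ℕ → List ℕ → List ℕ
  | [], A => A
  | b :: bs, A =>
    match A.find? (fun a => decide (b < a)) with
    | some a => unpairedUpper bs (A.erase a)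
    | none => unpairedUpper bs A

/-- As in `unpairedUpper`, but returns the unpaired letters of `r^{(i)}`. -/
def unpairedLower : List ℕ → List ℕ → List ℕ
  | [], _ => []
  | b :: bs, A =>
    match A.find? (fun a => decide (b < a)) with
    | some a => unpairedLower bs (A.erase a)
    | none => b :: unpairedLower bs A

/-- Insert a letter into a weakly increasing list, keeping it increasing. -/
def insAsc (x : ℕ) : List ℕ → List ℕ
  | [] => [x]
  | y :: ys => if x ≤ y then x :: y :: ys else y :: insAsc x ys

/-- The Morse–Schilling raising operator `e_i`: if every letter of block `i+1` is paired,
the result is `none` (i.e. `0`); otherwise the largest unpaired letter `a` of block `i+1` is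
removed and `a + s` is added to block `i`, where `s = min {j ≥ 0 | a+j+1 ∉ r^{(i+1)}}`. -/
def msE (i : ℕ) (f : ℕ → List ℕ) : Option (ℕ → List ℕ) :=
  let B := f i
  let A := f (i + 1)
  let L := unpairedUpper B.reverse A
  if L = [] then none
  else
    let a := L.foldr max 0
    let s := sInf {j : ℕ | (a + j + 1) ∉ A}
    some (Function.update (Function.update f (i + 1) (A.erase a)) i (insAsc (a + s) B))

/-- The Morse–Schilling lowering operator `f_i`: if every letter of block `i` is paired,
the result is `none`; otherwise the smallest unpaired letter `b` of block `i` is removed and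
`b - t` is added to block `i+1`, where `t = min {j ≥ 0 | b-j-1 ∉ r^{(i)}}`. -/
def msF (i : ℕ) (f : ℕ → List ℕ) : Option (ℕ → List ℕ) :=
  let B := f i
  let A := f (i + 1)
  let R := unpairedLower B.reverse A
  if R = [] then none
  else
    let b := R.foldr min R.headI
    let t := sInf {j : ℕ | (b - j - 1) ∉ B}
    some (Function.update (Function.update f i (B.erase b)) (i + 1) (insAsc (b - t) A))

/-- Iteration `e_j^k` of the raising operator. -/
def msEIter (j : ℕ) : ℕ → (ℕ → List ℕ) → Option (ℕ → List ℕ)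
  | 0, f => some f
  | k + 1, f => (msE j f).bind (msEIter j k)

/-- The Demazure operator `𝔇_j` on subsets of the crystal `RF_n(w)`:
`𝔇_j X = {b ∈ RF_n(w) | e_j^k(b) ∈ X for some k ≥ 0}`. -/
def demOp (n : ℕ) (w : Equiv.Perm ℕ) (j : ℕ) (X : Set (ℕ → List ℕ)) : Set (ℕ → List ℕ) :=
  {b | b ∈ RFn n w ∧ ∃ (k : ℕ) (c : ℕ → List ℕ), msEIter j k b = some c ∧ c ∈ X}

/-- `𝔇_{i_1} 𝔇_{i_2} ⋯ 𝔇_{i_k} X` for a word `i_1 i_2 ⋯ i_k` (the head is applied last). -/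
def demWord (n : ℕ) (w : Equiv.Perm ℕ) : List ℕ → Set (ℕ → List ℕ) → Set (ℕ → List ℕ)
  | [], X => X
  | j :: rest, X => demOp n w j (demWord n w rest X)

/-- `𝔇_{b↓a} = 𝔇_{b-1} 𝔇_{b-2} ⋯ 𝔇_a` (the identity when `b ≤ a`). -/
def demDown (n : ℕ) (w : Equiv.Perm ℕ) (b a : ℕ) (X : Set (ℕ → List ℕ)) :
    Set (ℕ → List ℕ) :=
  demWord n w ((List.range' a (b - a)).reverse) X

/-! ### Key tableaux -/

/-- A key tableau: a filling of a left-justified diagram in the positively indexed rows,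
with positive entries, weakly decreasing rows, distinct column entries, and the key
condition (c) of Assaf–Schilling. -/
def IsKeyTableau (T : Tableau) : Prop :=
  (∀ (r : ℤ) (c : ℕ), r ≤ 0 → T r c = 0) ∧
  (∀ r : ℤ, T r 0 = 0) ∧
  {p : ℤ × ℕ | T p.1 p.2 ≠ 0}.Finite ∧
  (∀ (r : ℤ) (c : ℕ), 1 ≤ c → T r (c + 1) ≠ 0 → T r c ≠ 0) ∧
  (∀ (r : ℤ) (c : ℕ), 1 ≤ c → T r (c + 1) ≠ 0 → T r (c + 1) ≤ T r c) ∧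
  (∀ (r r' : ℤ) (c : ℕ), r ≠ r' → T r c ≠ 0 → T r' c ≠ 0 → T r c ≠ T r' c) ∧
  (∀ (r r' : ℤ) (c : ℕ), r < r' → T r c ≠ 0 → T r' c ≠ 0 → T r' c < T r c →
      T r (c + 1) ≠ 0 ∧ T r' c < T r (c + 1))

/-- The tableau is `φ`-flagged: every entry in row `i` is at most `φ(i)`. -/
def FlaggedTab (φ : ℕ → ℕ) (T : Tableau) : Prop := ∀ (i c : ℕ), T (i : ℤ) c ≤ φ i

/-- `SSKT(α, φ)`: the `φ`-flagged key tableaux of shape `α`. -/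
def SSKT (α φ : ℕ → ℕ) : Set Tableau :=
  {T | IsKeyTableau T ∧ shapeOf T = α ∧ FlaggedTab φ T}

/-- The weight of a tableau: `wt(T)_v` is the number of entries equal to `v`. -/
def wtTab (T : Tableau) : ℕ → ℕ := fun v =>
  if v = 0 then 0 else Set.ncard {p : ℤ × ℕ | T p.1 p.2 = v}

/-- The weight of a word: the multiplicity of each positive letter. -/
def wtWord (u : List ℕ) : ℕ → ℕ := fun v => if v = 0 then 0 else u.count v

/-- The statistic `m_i(col(T), j)` where position `j` of the reverse column reading word
(entries read down columns, from right to left) is the box in row `r`, column `c`: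
the number of entries `i+1` weakly after this box minus the number of entries `i`. -/
def mi (T : Tableau) (i : ℕ) (r : ℤ) (c : ℕ) : ℤ :=
  (Set.ncard {p : ℤ × ℕ | T p.1 p.2 = i + 1 ∧ (p.2 < c ∨ (p.2 = c ∧ p.1 ≤ r))} : ℤ) -
  (Set.ncard {p : ℤ × ℕ | T p.1 p.2 = i ∧ (p.2 < c ∨ (p.2 = c ∧ p.1 ≤ r))} : ℤ)

/-- The box `(r, c)` maximizes `m_i` among all boxes of `T`. -/
def isMaxBox (T : Tableau) (i : ℕ) (r : ℤ) (c : ℕ) : Prop :=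
  T r c ≠ 0 ∧ ∀ (r' : ℤ) (c' : ℕ), T r' c' ≠ 0 → mi T i r' c' ≤ mi T i r c

/-- The Assaf–Schilling raising operator `e_i` on key tableaux.  If `m_i(col(T)) ≤ 0` the
result is `none` (i.e. `0`); otherwise, with `q` the largest position of the reverse column
reading word achieving the maximum (i.e. the maximizing box with the smallest column index,
and the smallest row index in that column), all entries `i+1` in the row of `q` weakly to its
right are changed to `i`, and all entries `i` in the same columns as these entries are
changed to `i+1`. -/
def keyE (i : ℕ) (T : Tableau) : Option Tableau :=
  if h : ∃ (r : ℤ) (c : ℕ), isMaxBox T i r c ∧ 1 ≤ mi T i r c then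
    let cq := sInf {c : ℕ | ∃ r : ℤ, isMaxBox T i r c}
    let rq : ℤ := ((sInf {m : ℕ | isMaxBox T i ((m : ℕ) : ℤ) cq} : ℕ) : ℤ)
    some (fun r c =>
      if cq ≤ c ∧ T rq c = i + 1 then
        (if T r c = i + 1 then i else if T r c = i then i + 1 else T r c)
      else T r c)
  else none

/-- The Assaf–Schilling lowering operator `f_i`: the (unique) inverse of `e_i`. -/
def keyF (i : ℕ) (T : Tableau) : Option Tableau :=
  if h : ∃ T', keyE i T' = some T then some h.choose else none

/-- Restriction of a partially defined crystal operator to a subset: the operator returns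
`none` (i.e. `0`) whenever it would leave the subset. -/
def restrictOp {β : Type} (S : Set β) (op : β → Option β) (x : β) : Option β :=
  (op x).bind fun y => if y ∈ S then some y else none

/-! ### Polynomials: divided differences and key polynomials -/

/-- The divided difference operator `∂_i f = (f - s_i · f) / (x_i - x_{i+1})`. -/
def divDiff (i : ℕ) (fp : MvPolynomial ℕ ℤ) : MvPolynomial ℕ ℤ :=
  if h : ∃ g : MvPolynomial ℕ ℤ,
      g * (MvPolynomial.X i - MvPolynomial.X (i + 1)) =
        fp - MvPolynomial.rename (fun j => sPerm i j) fp
  then h.choose else 0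

/-- The isobaric divided difference operator `π_i f = ∂_i (x_i f)`. -/
def piOp (i : ℕ) (fp : MvPolynomial ℕ ℤ) : MvPolynomial ℕ ℤ :=
  divDiff i (MvPolynomial.X i * fp)

/-- `π_{i_1} π_{i_2} ⋯ π_{i_k} f` for a word `i_1 i_2 ⋯ i_k` (the head is applied last). -/
def piWord : List ℕ → MvPolynomial ℕ ℤ → MvPolynomial ℕ ℤ
  | [], fp => fp
  | i :: rest, fp => piOp i (piWord rest fp)

/-- `π_{b↓a} = π_{b-1} π_{b-2} ⋯ π_a` (the identity when `b ≤ a`). -/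
def piDown (b a : ℕ) (fp : MvPolynomial ℕ ℤ) : MvPolynomial ℕ ℤ :=
  piWord ((List.range' a (b - a)).reverse) fp

/-- The conjugate of a weak composition: `conjC α t = #{j ≥ 1 | α_j ≥ t}` for `t ≥ 1`. -/
def conjC (α : ℕ → ℕ) (t : ℕ) : ℕ :=
  Set.ncard {j : ℕ | 1 ≤ j ∧ 1 ≤ t ∧ t ≤ α j}

/-- The partition rearrangement of a weak composition (the conjugate of its conjugate). -/
def sortC (α : ℕ → ℕ) : ℕ → ℕ := conjC (conjC α)

/-- The length of a permutation: the common length of its reduced words. -/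
def permLength (w : Equiv.Perm ℕ) : ℕ :=
  sInf {n : ℕ | ∃ ρ : List ℕ, PosWord ρ ∧ wordPerm ρ = w ∧ ρ.length = n}

/-- The monomial `x^β = x_1^{β_1} x_2^{β_2} ⋯`. -/
def xExp (β : ℕ → ℕ) : MvPolynomial ℕ ℤ :=
  ∏ i ∈ Finset.range (sSup {n : ℕ | β n ≠ 0} + 1), MvPolynomial.X i ^ β i

/-- The key polynomial `κ_α = π_w x^λ` where `λ` is the partition rearrangement of `α` and
`w` is the minimal-length permutation of `S∞` with `α · w = λ`. -/
def keyPoly (α : ℕ → ℕ) : MvPolynomial ℕ ℤ :=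
  if h : ∃ (ρ : List ℕ) (w : Equiv.Perm ℕ), IsReducedWordFor w ρ ∧
      (∀ i, α (w i) = sortC α i) ∧
      (∀ v : Equiv.Perm ℕ, (∃ τ, IsReducedWordFor v τ) → (∀ i, α (v i) = sortC α i) →
        permLength w ≤ permLength v)
  then piWord h.choose (xExp (sortC α)) else 0

/-- The `φ`-flagged key polynomial `κ_{(α,φ)} = Σ_{T ∈ SSKT(α,φ)} x^{wt(T)}`. -/
def flaggedKeyPoly (α φ : ℕ → ℕ) : MvPolynomial ℕ ℤ :=
  ∑ᶠ T ∈ SSKT α φ, xExp (wtTab T)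

/-! ### Column insertion, keys, standardization -/

/-- The number of boxes in column `c` of a tableau. -/
def colHeightN (T : Tableau) (c : ℕ) : ℕ := Set.ncard {r : ℤ | T r c ≠ 0}

/-- One pass of column insertion: insert the value `x` starting at column `c`
(`fuel` bounds the number of columns visited). -/
def colInsertAux : ℕ → Tableau → ℕ → ℕ → Tableau
  | 0, T, _, _ => T
  | fuel + 1, T, c, x =>
    if ∀ r : ℤ, T r c ≠ 0 → T r c < x then
      -- x is greater than every entry of column c: place it at the end of the column
      fun r c' => if c' = c ∧ r = (colHeightN T c + 1 : ℤ) then x else T r c'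
    else if ∃ r : ℤ, T r c = x then
      -- column c contains x: move on to the next column with the same value
      colInsertAux fuel T (c + 1) x
    else
      -- bump the smallest entry of column c that is larger than x
      let y := sInf {v : ℕ | x < v ∧ ∃ r : ℤ, T r c = v}
      colInsertAux fuel (fun r c' => if c' = c ∧ T r c' = y then x else T r c') (c + 1) y

/-- Column insertion of `x` into the semistandard Young tableau `T`. -/
def colInsert (T : Tableau) (x : ℕ) : Tableau :=
  colInsertAux (sSup {c : ℕ | ∃ r : ℤ, T r c ≠ 0} + 2) T 1 x

/-- The insertion tableau `P` of `(v → ∅)`: successively column insert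
`v_n, v_{n-1}, …, v_1` into the empty tableau. -/
def insertP (v : List ℕ) : Tableau :=
  v.reverse.foldl colInsert (fun _ _ => 0)

/-- The recording tableau `Q` of `(v → ∅)`: the standard Young tableau whose restriction to
`{1, …, j}` has the same shape as the insertion tableau of the last `j` letters of `v`. -/
def insertQ (v : List ℕ) : Tableau := fun r c =>
  sInf {j : ℕ | insertP (v.drop (v.length - j)) r c ≠ 0}

/-- The key `key(α)`: the unique semistandard Young tableau of weight `α` such that the set
of entries of column `i+1` is a subset of the entries of column `i`; its column `c` consists
of the elements of `{x ≥ 1 | α_x ≥ c}` in increasing order from bottom to top. -/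
def keyTab (α : ℕ → ℕ) : Tableau := fun r c =>
  if c = 0 then 0
  else sInf {x : ℕ | 1 ≤ x ∧ c ≤ α x ∧
    ((Set.ncard {y : ℕ | 1 ≤ y ∧ c ≤ α y ∧ y ≤ x} : ℕ) : ℤ) = r}

/-- The standardization of a semistandard Young tableau: the `1`'s are replaced from left to
right by `1, …, β_1`, the `2`'s by `β_1 + 1, …, β_1 + β_2`, and so on. -/
def stdTab (T : Tableau) : Tableau := fun r c =>
  if T r c = 0 then 0
  else Set.ncard {p : ℤ × ℕ |
    T p.1 p.2 ≠ 0 ∧ (T p.1 p.2 < T r c ∨ (T p.1 p.2 = T r c ∧ p.2 ≤ c))}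

/-! ### Maximal factorizations (Reiner–Shimozono) -/

/-- Every block is weakly increasing. -/
def WeaklyIncrFact (g : ℕ → List ℕ) : Prop := ∀ i, List.Chain' (· ≤ ·) (g i)

/-- Maximality: the nonempty blocks have maximal length, i.e. there is a strict descent
between any two consecutive nonempty blocks (no letter can be moved from the end of a block
to the front of the next one to the right). -/
def MaxFact (g : ℕ → List ℕ) : Prop :=
  ∀ i j : ℕ, 1 ≤ i → i < j → g i ≠ [] → g j ≠ [] → (∀ m, i < m → m < j → g m = []) →
    (g i).headI < (g j).getLastD 0

/-- Reiner–Shimozono's set `𝒲(α, φ)` of `φ`-flagged maximal factorizations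
`u^• = u^n ⋯ u^2 u^1` with `ℓ(u^i) = α_i` and `(u → ∅) = (P, std(key(α)))`. -/
def Wset (α φ : ℕ → ℕ) : Set (ℕ → List ℕ) :=
  {g | g 0 = [] ∧ (∀ i, (g i).length = α i) ∧ (∀ i, ∀ x ∈ g i, 1 ≤ x) ∧
       WeaklyIncrFact g ∧ MaxFact g ∧ (∀ i, ∀ x ∈ g i, x ≤ φ i) ∧
       insertQ (factWord g) = stdTab (keyTab α)}

/-! ### Shifts and highest weight key tableaux -/

/-- `shift_N`: add `N` to every letter of every block. -/
def shiftFact (N : ℕ) (f : ℕ → List ℕ) : ℕ → List ℕ := fun i => (f i).map (· + N)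

/-- The tableau of shape `α` whose column `i` is filled by `1, 2, …, λ^T_i` in increasing
order from bottom to top (where `λ^T` is the conjugate of the partition rearrangement `λ`
of `α`): the box of column `c` in row `m` (where `α_m ≥ c`) contains the number of indices
`m' ≤ m` with `α_{m'} ≥ c`. -/
def highKeyTab (α : ℕ → ℕ) : Tableau := fun r c =>
  if c = 0 then 0
  else if ∃ m : ℕ, (m : ℤ) = r ∧ 1 ≤ m ∧ c ≤ α m then
    Set.ncard {m : ℕ | 1 ≤ m ∧ c ≤ α m ∧ (m : ℤ) ≤ r}
  else 0


/-- A `gl_n`-crystal isomorphism between two sets of key tableaux, both equipped with the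
Assaf–Schilling operators (restricted to the sets): a weight-preserving bijection commuting
with all raising and lowering operators `e_i, f_i` for `1 ≤ i < n`. -/
def SSKTIso (n : ℕ) (S₁ S₂ : Set Tableau) : Prop :=
  ∃ g : Tableau → Tableau, Set.BijOn g S₁ S₂ ∧
    (∀ T ∈ S₁, wtTab T = wtTab (g T)) ∧
    ∀ T ∈ S₁, ∀ i : ℕ, 1 ≤ i → i < n →
      Option.map g (restrictOp S₁ (keyE i) T) = restrictOp S₂ (keyE i) (g T) ∧
      Option.map g (restrictOp S₁ (keyF i) T) = restrictOp S₂ (keyF i) (g T)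

/-! ### Helper lemmas -/

/-- A finite set of positive integers closed under positive predecessors is `{1, …, K}` with
`K` its cardinality. -/
lemma mem_iff_le_ncard_of_lower {s : Set ℕ} (hs : s.Finite) (hpos : ∀ x ∈ s, 1 ≤ x)
    (hlow : ∀ x ∈ s, ∀ y, 1 ≤ y → y ≤ x → y ∈ s) {c : ℕ} (hc : 1 ≤ c) :
    c ∈ s ↔ c ≤ s.ncard := by
  constructor
  · intro h
    have hsub : ((Finset.Icc 1 c : Finset ℕ) : Set ℕ) ⊆ s := by
      intro y hy
      rw [Finset.mem_coe, Finset.mem_Icc] at hy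
      exact hlow c h y hy.1 hy.2
    have := Set.ncard_le_ncard hsub hs
    rw [Set.ncard_coe_finset] at this
    simpa using this
  · intro h
    by_contra hcs
    have hsub : s ⊆ ((Finset.Icc 1 (c - 1) : Finset ℕ) : Set ℕ) := by
      intro y hy
      rw [Finset.mem_coe, Finset.mem_Icc]
      refine ⟨hpos y hy, ?_⟩
      by_contra hlt
      exact hcs (hlow y hy c hc (by omega))
    have := Set.ncard_le_ncard hsub (Finset.finite_toSet _)
    rw [Set.ncard_coe_finset, Nat.card_Icc] at this
    omega

lemma WeakComp.finite_setOf_le {α : ℕ → ℕ} (hα : WeakComp α) {c : ℕ} (hc : 1 ≤ c) :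
    {m : ℕ | 1 ≤ m ∧ c ≤ α m}.Finite :=
  hα.2.subset fun m hm => by
    have := hm.2
    simp only [Set.mem_ofPred_eq]
    omega

lemma conjC_eq {α : ℕ → ℕ} {t : ℕ} (ht : 1 ≤ t) :
    conjC α t = {j : ℕ | 1 ≤ j ∧ t ≤ α j}.ncard := by
  simp [conjC, ht]

lemma conjC_antitone {α : ℕ → ℕ} (hα : WeakComp α) {s t : ℕ} (hs : 1 ≤ s) (hst : s ≤ t) :
    conjC α t ≤ conjC α s := by
  rw [conjC_eq hs, conjC_eq (hs.trans hst)]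
  exact Set.ncard_le_ncard (fun j hj => ⟨hj.1, hst.trans hj.2⟩) (hα.finite_setOf_le hs)

/-- Conjugation is an involution on partitions. -/
lemma conjC_conjC {β : ℕ → ℕ} (hanti : ∀ s t, 1 ≤ s → s ≤ t → β t ≤ β s)
    (hfin : ∀ t, 1 ≤ t → {j : ℕ | 1 ≤ j ∧ t ≤ β j}.Finite) {c : ℕ} (hc : 1 ≤ c) :
    conjC (conjC β) c = β c := by
  have hset : {t : ℕ | 1 ≤ t ∧ c ≤ conjC β t} = ((Finset.Icc 1 (β c) : Finset ℕ) : Set ℕ) := by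
    ext t
    simp only [Set.mem_ofPred_eq, Finset.coe_Icc, Set.mem_Icc]
    refine and_congr_right fun ht => ?_
    rw [conjC_eq ht, ← mem_iff_le_ncard_of_lower (hfin t ht) (fun x hx => hx.1)
      (fun x hx y hy hyx => ⟨hy, hx.2.trans (hanti y x hy hyx)⟩) hc]
    simp [hc]
  rw [conjC_eq hc, hset, Set.ncard_coe_finset, Nat.card_Icc]
  omega

lemma conjC_sortC {α : ℕ → ℕ} (hα : WeakComp α) {c : ℕ} (hc : 1 ≤ c) :
    conjC (sortC α) c = conjC α c := by
  refine conjC_conjC (fun s t => conjC_antitone hα) (fun t ht => ?_) hc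
  obtain ⟨N, hN⟩ := (hα.2.image α).bddAbove
  refine (Set.finite_Iic N).subset fun j hj => ?_
  by_contra hlt
  have hempty : {m : ℕ | 1 ≤ m ∧ j ≤ α m} = ∅ := by
    refine Set.eq_empty_of_forall_notMem fun m hm => hlt ?_
    have h0 : α m ≠ 0 := by
      have := hm.2
      have := hj.1
      omega
    exact hm.2.trans (hN ⟨m, h0, rfl⟩)
  have h2 := hj.2
  rw [conjC_eq hj.1, hempty, Set.ncard_empty] at h2
  omega

lemma highKeyTab_natCast {α : ℕ → ℕ} {m c : ℕ} (hc : 1 ≤ c) (hm : 1 ≤ m) (h : c ≤ α m) :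
    highKeyTab α m c = {k : ℕ | 1 ≤ k ∧ c ≤ α k ∧ k ≤ m}.ncard := by
  have h1 : ∃ k : ℕ, (k : ℤ) = (m : ℤ) ∧ 1 ≤ k ∧ c ≤ α k := ⟨m, rfl, hm, h⟩
  have h2 : c ≠ 0 := by omega
  rw [highKeyTab, if_neg h2, if_pos h1]
  simp only [Nat.cast_le]

lemma highKeyTab_natCast_eq_count {α : ℕ → ℕ} {m c : ℕ} (hc : 1 ≤ c) (hm : 1 ≤ m)
    (h : c ≤ α m) :
    highKeyTab α m c = Nat.count (fun k => 1 ≤ k ∧ c ≤ α k) m + 1 := by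
  have hsucc : Nat.count (fun k => 1 ≤ k ∧ c ≤ α k) (m + 1) =
      Nat.count (fun k => 1 ≤ k ∧ c ≤ α k) m + 1 := by
    rw [Nat.count_succ, if_pos ⟨hm, h⟩]
  rw [highKeyTab_natCast hc hm h, ← hsucc, Nat.count_eq_card_filter_range,
    ← Set.ncard_coe_finset]
  congr 1
  ext k
  simp only [Set.mem_ofPred_eq, Finset.coe_filter, Finset.mem_range]
  constructor
  · rintro ⟨h1, h2, h3⟩
    exact ⟨by omega, h1, h2⟩
  · rintro ⟨h1, h2, h3⟩
    exact ⟨h2, h3, by omega⟩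

lemma highKeyTab_ne_zero_iff {α : ℕ → ℕ} {r : ℤ} {c : ℕ} :
    highKeyTab α r c ≠ 0 ↔ ∃ m : ℕ, (m : ℤ) = r ∧ 1 ≤ m ∧ 1 ≤ c ∧ c ≤ α m := by
  constructor
  · intro h
    by_cases hc : c = 0
    · simp [highKeyTab, hc] at h
    · by_cases h1 : ∃ m : ℕ, (m : ℤ) = r ∧ 1 ≤ m ∧ c ≤ α m
      · obtain ⟨m, hm, hm1, hcm⟩ := h1
        exact ⟨m, hm, hm1, by omega, hcm⟩
      · rw [highKeyTab, if_neg hc, if_neg h1] at h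
        exact absurd rfl h
  · rintro ⟨m, rfl, hm, hc, hcm⟩
    rw [highKeyTab_natCast_eq_count hc hm hcm]
    exact Nat.succ_ne_zero _

lemma highKeyTab_lt {α : ℕ → ℕ} {r r' : ℤ} {c : ℕ} (hrr : r < r')
    (h : highKeyTab α r c ≠ 0) (h' : highKeyTab α r' c ≠ 0) :
    highKeyTab α r c < highKeyTab α r' c := by
  obtain ⟨m, rfl, hm, hc, hcm⟩ := highKeyTab_ne_zero_iff.1 h
  obtain ⟨n, rfl, hn, -, hcn⟩ := highKeyTab_ne_zero_iff.1 h'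
  rw [highKeyTab_natCast_eq_count hc hm hcm, highKeyTab_natCast_eq_count hc hn hcn]
  have hmn : m < n := by exact_mod_cast hrr
  exact Nat.succ_lt_succ (Nat.count_strict_mono ⟨hm, hcm⟩ hmn)

lemma highKeyTab_exists_pred {α : ℕ → ℕ} {r : ℤ} {c i : ℕ} (hi : 1 ≤ i)
    (h : highKeyTab α r c = i + 1) : ∃ r' < r, highKeyTab α r' c = i := by
  obtain ⟨m, rfl, hm, hc, hcm⟩ := highKeyTab_ne_zero_iff.1 (h.trans_ne i.succ_ne_zero)
  rw [highKeyTab_natCast_eq_count hc hm hcm] at h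
  have hlt : i - 1 < Nat.count (fun k => 1 ≤ k ∧ c ≤ α k) m := by omega
  have hcard : ∀ hf : (Set.ofPred fun k => 1 ≤ k ∧ c ≤ α k).Finite, i - 1 < hf.toFinset.card :=
    fun hf => hlt.trans_le (Nat.count_le_card hf m)
  obtain ⟨h1, h2⟩ := Nat.nth_mem _ hcard
  refine ⟨Nat.nth _ (i - 1), by exact_mod_cast Nat.nth_lt_of_lt_count hlt, ?_⟩
  rw [highKeyTab_natCast_eq_count hc h1 h2, Nat.count_nth hcard]
  omega

lemma colHeightN_highKeyTab {α : ℕ → ℕ} {c : ℕ} (hc : 1 ≤ c) :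
    colHeightN (highKeyTab α) c = conjC α c := by
  have hset : {r : ℤ | highKeyTab α r c ≠ 0} =
      (fun m : ℕ => (m : ℤ)) '' {m : ℕ | 1 ≤ m ∧ c ≤ α m} := by
    ext r
    simp only [Set.mem_ofPred_eq, highKeyTab_ne_zero_iff, Set.mem_image]
    constructor
    · rintro ⟨m, hm, h1, -, h2⟩
      exact ⟨m, ⟨h1, h2⟩, hm⟩
    · rintro ⟨m, ⟨h1, h2⟩, hm⟩
      exact ⟨m, hm, h1, hc, h2⟩
  rw [colHeightN, hset, Set.ncard_image_of_injective _ Nat.cast_injective, conjC_eq hc]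

lemma highKeyTab_mem_SSKT {α φ : ℕ → ℕ} (hα : WeakComp α) (hφ : IsFlag φ) :
    highKeyTab α ∈ SSKT α φ := by
  refine ⟨⟨?_, ?_, ?_, ?_, ?_, ?_, ?_⟩, ?_, ?_⟩
  · intro r c hr
    by_contra h
    obtain ⟨m, rfl, hm, -⟩ := highKeyTab_ne_zero_iff.1 h
    omega
  · intro r
    simp [highKeyTab]
  · obtain ⟨N, hN⟩ := (hα.2.image α).bddAbove
    refine ((hα.2.image (fun m : ℕ => (m : ℤ))).prod (Set.finite_Iic N)).subset ?_
    rintro ⟨r, c⟩ h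
    obtain ⟨m, hm, hm1, hc, hcm⟩ := highKeyTab_ne_zero_iff.1 h
    have h0 : α m ≠ 0 := by omega
    exact ⟨⟨m, h0, hm⟩, hcm.trans (hN ⟨m, h0, rfl⟩)⟩
  · intro r c hc h
    obtain ⟨m, hm, hm1, -, hcm⟩ := highKeyTab_ne_zero_iff.1 h
    exact highKeyTab_ne_zero_iff.2 ⟨m, hm, hm1, hc, by omega⟩
  · intro r c hc h
    obtain ⟨m, rfl, hm1, -, hcm⟩ := highKeyTab_ne_zero_iff.1 h
    rw [highKeyTab_natCast (by omega) hm1 hcm, highKeyTab_natCast hc hm1 (by omega)]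
    refine Set.ncard_le_ncard (fun k hk => ⟨hk.1, ?_, hk.2.2⟩)
      ((Set.finite_Iic m).subset fun k hk => hk.2.2)
    have := hk.2.1
    omega
  · intro r r' c hne h h'
    rcases lt_or_gt_of_ne hne with hlt | hlt
    · exact (highKeyTab_lt hlt h h').ne
    · exact (highKeyTab_lt hlt h' h).ne'
  · intro r r' c hlt h h' hgt
    exact absurd hgt (highKeyTab_lt hlt h h').le.not_gt
  · funext m
    have hset : {c : ℕ | highKeyTab α m c ≠ 0} = ((Finset.Icc 1 (α m) : Finset ℕ) : Set ℕ) := by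
      ext c
      simp only [Set.mem_ofPred_eq, highKeyTab_ne_zero_iff, Finset.coe_Icc, Set.mem_Icc]
      constructor
      · rintro ⟨k, hk, -, h⟩
        obtain rfl : k = m := by exact_mod_cast hk
        exact h
      · rintro ⟨h1, h2⟩
        refine ⟨m, rfl, Nat.one_le_iff_ne_zero.2 ?_, h1, h2⟩
        rintro rfl
        have := hα.1
        omega
    rw [shapeOf, hset, Set.ncard_coe_finset, Nat.card_Icc]
    omega
  · intro m c
    by_cases h : highKeyTab α m c = 0
    · omega
    · obtain ⟨k, hk, hk1, hc, hck⟩ := highKeyTab_ne_zero_iff.1 h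
      obtain rfl : k = m := by exact_mod_cast hk
      refine le_trans ?_ (hφ.2 k hk1)
      rw [highKeyTab_natCast hc hk1 hck]
      have hsub : {j : ℕ | 1 ≤ j ∧ c ≤ α j ∧ j ≤ k} ⊆
          ((Finset.Icc 1 k : Finset ℕ) : Set ℕ) := by
        intro j hj
        rw [Finset.mem_coe, Finset.mem_Icc]
        exact ⟨hj.1, hj.2.2⟩
      have := Set.ncard_le_ncard hsub (Finset.finite_toSet _)
      rw [Set.ncard_coe_finset, Nat.card_Icc] at this
      omega

/-- The boxes with entry `v` weakly after the box `(r, c)` in the column reading word. -/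
def boxesAfter (T : Tableau) (v : ℕ) (r : ℤ) (c : ℕ) : Set (ℤ × ℕ) :=
  {p : ℤ × ℕ | T p.1 p.2 = v ∧ (p.2 < c ∨ (p.2 = c ∧ p.1 ≤ r))}

lemma mi_nonpos_iff {T : Tableau} {i : ℕ} {r : ℤ} {c : ℕ} :
    mi T i r c ≤ 0 ↔ (boxesAfter T (i + 1) r c).ncard ≤ (boxesAfter T i r c).ncard := by
  rw [mi, sub_nonpos, Nat.cast_le]
  rfl

lemma IsKeyTableau.finite_boxesAfter {T : Tableau} (hT : IsKeyTableau T) {v : ℕ} (hv : 1 ≤ v)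
    (r : ℤ) (c : ℕ) : (boxesAfter T v r c).Finite :=
  hT.2.2.1.subset fun p hp => by
    have := hp.1
    simp only [Set.mem_ofPred_eq]
    omega

lemma IsKeyTableau.eq_of_entry_eq {T : Tableau} (hT : IsKeyTableau T) {v : ℕ} (hv : 1 ≤ v)
    {r r' : ℤ} {c : ℕ} (h : T r c = v) (h' : T r' c = v) : r = r' := by
  by_contra hne
  exact hT.2.2.2.2.2.1 r r' c hne (by omega) (by omega) (h.trans h'.symm)

/-- Since columns have distinct entries, boxes with a given entry are counted by columns. -/
lemma IsKeyTableau.ncard_boxesAfter {T : Tableau} (hT : IsKeyTableau T) {v : ℕ} (hv : 1 ≤ v)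
    (r : ℤ) (c : ℕ) : (boxesAfter T v r c).ncard = (Prod.snd '' boxesAfter T v r c).ncard := by
  refine (Set.InjOn.ncard_image ?_).symm
  rintro ⟨r₁, c₁⟩ h₁ ⟨r₂, c₂⟩ h₂ (rfl : c₁ = c₂)
  exact congrArg (·, c₁) (hT.eq_of_entry_eq hv h₁.1 h₂.1)

lemma keyE_eq_none_iff {T : Tableau} (hT : IsKeyTableau T) {i : ℕ} :
    keyE i T = none ↔ ∀ (r : ℤ) (c : ℕ), T r c ≠ 0 → mi T i r c ≤ 0 := by
  rw [keyE]
  split_ifs with h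
  · obtain ⟨r, c, hmax, hpos⟩ := h
    refine iff_of_false (by simp) fun hall => ?_
    have := hall r c hmax.1
    omega
  · refine iff_of_true rfl fun r c hrc => ?_
    by_contra hpos
    obtain ⟨⟨r₀, c₀⟩, hbox, hmax⟩ := Set.exists_max_image _
      (fun p : ℤ × ℕ => mi T i p.1 p.2) hT.2.2.1 ⟨(r, c), hrc⟩
    refine h ⟨r₀, c₀, ⟨hbox, fun r' c' h' => hmax (r', c') h'⟩, ?_⟩
    have : mi T i r c ≤ mi T i r₀ c₀ := hmax (r, c) hrc
    omega

/-- If every entry `i + 1` has an entry `i` below it in its column, then `e_i` vanishes. -/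
lemma keyE_eq_none_of_exists_pred {T : Tableau} (hT : IsKeyTableau T) {i : ℕ} (hi : 1 ≤ i)
    (h : ∀ (r : ℤ) (c : ℕ), T r c = i + 1 → ∃ r' < r, T r' c = i) : keyE i T = none := by
  rw [keyE_eq_none_iff hT]
  intro r c _
  rw [mi_nonpos_iff, hT.ncard_boxesAfter hi, hT.ncard_boxesAfter (Nat.le_add_left 1 i)]
  refine Set.ncard_le_ncard ?_ ((hT.finite_boxesAfter hi r c).image _)
  rintro _ ⟨⟨r₁, c₁⟩, ⟨h₁, h₂⟩, rfl⟩
  obtain ⟨r', hlt, hr'⟩ := h r₁ c₁ h₁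
  refine ⟨(r', c₁), ⟨hr', ?_⟩, rfl⟩
  rcases h₂ with h₂ | ⟨h₂, h₃⟩
  · exact Or.inl h₂
  · exact Or.inr ⟨h₂, hlt.le.trans h₃⟩

lemma IsKeyTableau.le_of_le {T : Tableau} (hT : IsKeyTableau T) {r : ℤ} {c d : ℕ} (hc : 1 ≤ c)
    (hcd : c ≤ d) (h : T r d ≠ 0) : T r d ≤ T r c := by
  induction d, hcd using Nat.le_induction with
  | base => exact le_rfl
  | succ d hd ih =>
    have hd1 := hc.trans hd
    exact (hT.2.2.2.2.1 r d hd1 h).trans (ih (hT.2.2.2.1 r d hd1 h))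

/-- Descending through predecessors: all smaller values occur weakly below an entry. -/
lemma exists_entry_eq_of_exists_pred {T : Tableau} {c : ℕ}
    (hpred : ∀ (r : ℤ) (i : ℕ), 1 ≤ i → T r c = i + 1 → ∃ r' < r, T r' c = i)
    {v : ℕ} (hv : 1 ≤ v) {r : ℤ} (h : v ≤ T r c) : ∃ r' ≤ r, T r' c = v := by
  obtain ⟨w, hw⟩ : ∃ w, w = T r c := ⟨_, rfl⟩
  rw [← hw] at h
  induction w, h using Nat.le_induction generalizing r with
  | base => exact ⟨r, le_rfl, hw.symm⟩
  | succ w hvw ih =>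
    obtain ⟨r', hlt, hr'⟩ := hpred r w (hv.trans hvw) hw.symm
    obtain ⟨r'', hle, hr''⟩ := ih hr'.symm
    exact ⟨r'', hle.trans hlt.le, hr''⟩

/-- In a highest weight key tableau, every entry `i + 1` has an entry `i` below it in its
column. -/
lemma IsKeyTableau.exists_pred_of_keyE_eq_none {T : Tableau} (hT : IsKeyTableau T)
    (he : ∀ i : ℕ, 1 ≤ i → keyE i T = none) (c : ℕ) :
    ∀ (r : ℤ) (i : ℕ), 1 ≤ i → T r c = i + 1 → ∃ r' < r, T r' c = i := by
  induction c using Nat.strong_induction_on with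
  | _ c ih =>
    intro r i hi hrc
    by_contra hno
    have hle := mi_nonpos_iff.1 ((keyE_eq_none_iff hT).1 (he i hi) r c (by omega))
    rw [hT.ncard_boxesAfter hi, hT.ncard_boxesAfter (Nat.le_add_left 1 i)] at hle
    refine absurd hle (not_le.2 (Set.ncard_lt_ncard ?_
      ((hT.finite_boxesAfter (Nat.le_add_left 1 i) r c).image _)))
    have hnotMem : c ∉ Prod.snd '' boxesAfter T i r c := by
      rintro ⟨⟨r', _⟩, ⟨h₁, h₂⟩, rfl⟩
      rcases h₂ with h₂ | ⟨-, h₂⟩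
      · exact lt_irrefl _ h₂
      · refine hno ⟨r', lt_of_le_of_ne h₂ ?_, h₁⟩
        rintro rfl
        simp only at h₁ hrc
        omega
    refine (Set.ssubset_iff_of_subset ?_).2 ⟨c, ⟨(r, c), ⟨hrc, Or.inr ⟨rfl, le_rfl⟩⟩, rfl⟩, hnotMem⟩
    intro d hd
    have hdc : d ≠ c := fun hdc => hnotMem (hdc ▸ hd)
    obtain ⟨⟨r₁, _⟩, ⟨h₁, h₂⟩, rfl⟩ := hd
    simp only at h₁ h₂ hdc ⊢
    rename_i d
    have hlt : d < c := by omega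
    have hd1 : 1 ≤ d := by
      rcases Nat.eq_zero_or_pos d with rfl | h
      · rw [hT.2.1] at h₁
        omega
      · exact h
    have hrow := hT.le_of_le hd1 hlt.le (by omega : T r c ≠ 0)
    obtain ⟨r', -, hr'⟩ := exists_entry_eq_of_exists_pred (ih d hlt) (Nat.le_add_left 1 i)
      (hrc ▸ hrow)
    exact ⟨(r', d), ⟨hr', Or.inl hlt⟩, rfl⟩

lemma IsKeyTableau.ne_zero_iff {T : Tableau} (hT : IsKeyTableau T) {m c : ℕ} (hc : 1 ≤ c) :
    T m c ≠ 0 ↔ c ≤ shapeOf T m := by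
  have hpos : ∀ x ∈ {c : ℕ | T m c ≠ 0}, 1 ≤ x := by
    intro x hx
    rcases Nat.eq_zero_or_pos x with rfl | h
    · exact absurd (hT.2.1 m) hx
    · exact h
  refine mem_iff_le_ncard_of_lower (s := {c : ℕ | T m c ≠ 0})
    ((hT.2.2.1.image Prod.snd).subset fun x hx => ⟨((m : ℤ), x), hx, rfl⟩) hpos ?_ hc
  intro x hx y hy hyx
  have := hT.le_of_le hy hyx hx
  simp only [Set.mem_ofPred_eq] at hx ⊢
  omega

/-- A key tableau in which every entry `i + 1` has an entry `i` below it in its column is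
determined by its shape. -/
lemma IsKeyTableau.eq_highKeyTab {T : Tableau} (hT : IsKeyTableau T)
    (hpred : ∀ (c : ℕ) (r : ℤ) (i : ℕ), 1 ≤ i → T r c = i + 1 → ∃ r' < r, T r' c = i) :
    T = highKeyTab (shapeOf T) := by
  funext r c
  have hiff : T r c ≠ 0 ↔ highKeyTab (shapeOf T) r c ≠ 0 := by
    rw [highKeyTab_ne_zero_iff]
    constructor
    · intro h
      have hr : 0 < r := not_le.1 fun hr => h (hT.1 r c hr)
      have hc : 1 ≤ c := Nat.one_le_iff_ne_zero.2 fun hc => h (hc ▸ hT.2.1 r)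
      lift r to ℕ using hr.le
      exact ⟨r, rfl, by omega, hc, (hT.ne_zero_iff hc).1 h⟩
    · rintro ⟨m, rfl, -, hc, h⟩
      exact (hT.ne_zero_iff hc).2 h
  by_cases h0 : T r c = 0
  · rw [h0]
    by_contra h
    exact hiff.2 (Ne.symm h) h0
  obtain ⟨m, rfl, hm, hc, hcm⟩ := highKeyTab_ne_zero_iff.1 (hiff.1 h0)
  rw [highKeyTab_natCast hc hm hcm]
  have himage : (fun k : ℕ => T k c) '' {k : ℕ | 1 ≤ k ∧ c ≤ shapeOf T k ∧ k ≤ m} =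
      ((Finset.Icc 1 (T m c) : Finset ℕ) : Set ℕ) := by
    ext v
    simp only [Set.mem_image, Set.mem_ofPred_eq, Finset.coe_Icc, Set.mem_Icc]
    constructor
    · rintro ⟨k, ⟨-, hck, hkm⟩, rfl⟩
      have hk0 : 1 ≤ T k c := Nat.one_le_iff_ne_zero.2 ((hT.ne_zero_iff hc).2 hck)
      refine ⟨hk0, ?_⟩
      by_contra hlt
      obtain ⟨r', hr', h⟩ := exists_entry_eq_of_exists_pred (hpred c)
        (Nat.one_le_iff_ne_zero.2 h0) (not_le.1 hlt).le
      have := hT.eq_of_entry_eq (Nat.one_le_iff_ne_zero.2 h0) h rfl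
      have hkm' : k = m := by omega
      rw [hkm'] at hlt
      exact hlt le_rfl
    · rintro ⟨hv, hvm⟩
      obtain ⟨r', hr', h⟩ := exists_entry_eq_of_exists_pred (hpred c) hv hvm
      have hpos : 0 < r' := not_le.1 fun hle => by
        rw [hT.1 r' c hle] at h
        omega
      lift r' to ℕ using hpos.le
      exact ⟨r', ⟨by omega, (hT.ne_zero_iff hc).1 (by omega), by omega⟩, h⟩
  have hinj : Set.InjOn (fun k : ℕ => T k c) {k : ℕ | 1 ≤ k ∧ c ≤ shapeOf T k ∧ k ≤ m} := by
    intro k hk l hl hkl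
    have hl0 := (hT.ne_zero_iff hc).2 hl.2.1
    exact_mod_cast hT.eq_of_entry_eq (Nat.one_le_iff_ne_zero.2 hl0) hkl rfl
  rw [← hinj.ncard_image, himage, Set.ncard_coe_finset, Nat.card_Icc]
  omega

/-- Proposition `highest-prop`.
Let `λ` be the partition rearrangement of `α` and `λ^T` its conjugate.  The unique highest
weight element of `SSKT(α, φ)` (the unique `T` with `e_i(T) = 0` for all `i ≥ 1`) is the
tableau of shape `α` in which column `i` is filled by `1, 2, …, λ^T_i` in increasing order
from bottom to top. -/
theorem highest_weight_SSKT (α : ℕ → ℕ) (hα : WeakComp α) (φ : ℕ → ℕ) (hφ : IsFlag φ) :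
    (∀ c : ℕ, 1 ≤ c → colHeightN (highKeyTab α) c = conjC (sortC α) c) ∧
    highKeyTab α ∈ SSKT α φ ∧
    (∀ i : ℕ, 1 ≤ i → keyE i (highKeyTab α) = none) ∧
    (∀ T ∈ SSKT α φ, (∀ i : ℕ, 1 ≤ i → keyE i T = none) → T = highKeyTab α) := by
  have hmem := highKeyTab_mem_SSKT hα hφ
  refine ⟨fun c hc => ?_, hmem, fun i hi => ?_, fun T hT he => ?_⟩
  · rw [colHeightN_highKeyTab hc, conjC_sortC hα hc]
  · exact keyE_eq_none_of_exists_pred hmem.1 hi fun r c => highKeyTab_exists_pred hi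
  · rw [hT.1.eq_highKeyTab (hT.1.exists_pred_of_keyE_eq_none he), hT.2.1]

end
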